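/- arXiv:1011.4596 — 6 statements merged into one kernel-verified Lean document; each statement's English description precedes it below -/
import Mathlib

section
/- Let c₀ > 0, c > 0, R, V, d₁, d₀ ∈ ℝ, M ≥ 1, and let A_1, …, A_M ∈ ℝ, η_1, …, η_M ∈ ℝ, and κ_1, …, κ_M > 0 be pairwise distinct with c κ_i = 2 c₀ sin(κ_i/2). Define 𝓡(φ) = R + Σ_{i=1}^M A_i cos(κ_i φ + κ_i/2 + η_i), 𝓥(φ) = V − c₀ Σ_{i=1}^M A_i cos(κ_i φ + η_i), Φ(r) = ½ c₀² r² + d₁ r + d₀, and A² = Σ_{i=1}^M A_i². Then the oscillatory energy satisfies lim_{L→∞} (1/(2L)) ∫_{−L}^{L} [ ½ (𝓥(φ) − V)² + Φ(𝓡(φ)) − Φ(R) ] dφ = ½ c₀² A², and the total energy density satisfies lim_{L→∞} (1/(2L)) ∫_{−L}^{L} [ ½ 𝓥(φ)² + Φ(𝓡(φ)) ] dφ = ½ V² + ½ c₀² R² + d₁ R + d₀ + ½ c₀² A². -/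
open Filter intervalIntegral

/-- `f` is continuous and its averages over `[-L, L]` converge to `m` as `L → ∞`. -/
def HasMean (f : ℝ → ℝ) (m : ℝ) : Prop :=
  Continuous f ∧ Tendsto (fun L : ℝ => (1 / (2 * L)) * ∫ φ in (-L)..L, f φ) atTop (nhds m)

namespace HasMean

theorem congr {f g : ℝ → ℝ} {m n : ℝ} (hf : HasMean f m) (hfg : ∀ φ, f φ = g φ) (hmn : m = n) :
    HasMean g n :=
  hmn ▸ funext hfg ▸ hf

theorem const (k : ℝ) : HasMean (fun _ => k) k := by
  refine ⟨continuous_const, tendsto_const_nhds.congr' ?_⟩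
  filter_upwards [eventually_gt_atTop 0] with L hL
  rw [intervalIntegral.integral_const, smul_eq_mul]
  field_simp
  ring

theorem add {f g : ℝ → ℝ} {m n : ℝ} (hf : HasMean f m) (hg : HasMean g n) :
    HasMean (fun φ => f φ + g φ) (m + n) := by
  refine ⟨hf.1.add hg.1, (hf.2.add hg.2).congr fun L => ?_⟩
  rw [intervalIntegral.integral_add (hf.1.intervalIntegrable _ _) (hg.1.intervalIntegrable _ _)]
  ring

theorem const_mul {f : ℝ → ℝ} {m : ℝ} (k : ℝ) (hf : HasMean f m) :
    HasMean (fun φ => k * f φ) (k * m) := by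
  refine ⟨continuous_const.mul hf.1, (hf.2.const_mul k).congr fun L => ?_⟩
  rw [intervalIntegral.integral_const_mul]
  ring

theorem sum {ι : Type*} (s : Finset ι) {f : ι → ℝ → ℝ} {m : ι → ℝ}
    (hf : ∀ i ∈ s, HasMean (f i) (m i)) :
    HasMean (fun φ => ∑ i ∈ s, f i φ) (∑ i ∈ s, m i) := by
  classical
  induction s using Finset.induction_on with
  | empty => simpa using const 0
  | insert a s ha ih =>
    simp only [Finset.sum_insert ha]
    exact (hf a (Finset.mem_insert_self a s)).add
      (ih fun i hi => hf i (Finset.mem_insert_of_mem hi))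

theorem cos {a : ℝ} (ha : a ≠ 0) (b : ℝ) : HasMean (fun φ => Real.cos (a * φ + b)) 0 := by
  refine ⟨by fun_prop, ?_⟩
  have hint : ∀ L : ℝ, ∫ φ in (-L)..L, Real.cos (a * φ + b) =
      a⁻¹ * (Real.sin (a * L + b) - Real.sin (a * -L + b)) := fun L => by
    rw [intervalIntegral.integral_comp_mul_add (fun x => Real.cos x) ha, integral_cos, smul_eq_mul]
  have hlim : Tendsto (fun L : ℝ => 1 / (2 * L)) atTop (nhds 0) :=
    tendsto_const_nhds.div_atTop (tendsto_id.const_mul_atTop two_pos)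
  refine hlim.zero_mul_isBoundedUnder_le (isBoundedUnder_of ⟨|a⁻¹| * 2, fun L => ?_⟩)
  rw [Function.comp_apply, hint, Real.norm_eq_abs, abs_mul]
  gcongr
  rw [abs_le]
  constructor <;>
    linarith [Real.sin_le_one (a * L + b), Real.neg_one_le_sin (a * L + b),
      Real.sin_le_one (a * -L + b), Real.neg_one_le_sin (a * -L + b)]

theorem cos_mul_cos {a b : ℝ} (ha : 0 < a) (hb : 0 < b) (hab : a ≠ b) (x y : ℝ) :
    HasMean (fun φ => Real.cos (a * φ + x) * Real.cos (b * φ + y)) 0 := by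
  refine (((cos (sub_ne_zero.2 hab) (x - y)).add (cos (add_pos ha hb).ne' (x + y))).const_mul
    (1 / 2)).congr (fun φ => ?_) ?_
  · rw [show (a - b) * φ + (x - y) = (a * φ + x) - (b * φ + y) by ring,
      show (a + b) * φ + (x + y) = (a * φ + x) + (b * φ + y) by ring,
      Real.cos_sub (a * φ + x), Real.cos_add (a * φ + x)]
    ring
  · ring

theorem cos_sq {a : ℝ} (ha : 0 < a) (x : ℝ) :
    HasMean (fun φ => Real.cos (a * φ + x) * Real.cos (a * φ + x)) (1 / 2) := by
  refine (((const 1).add (cos (mul_pos two_pos ha).ne' (2 * x))).const_mul (1 / 2)).congr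
    (fun φ => ?_) ?_
  · rw [show 2 * a * φ + 2 * x = 2 * (a * φ + x) by ring, Real.cos_two_mul]
    ring
  · ring

theorem sum_cos {ι : Type*} [Fintype ι] {κ : ι → ℝ} (hκ : ∀ i, 0 < κ i) (A x : ι → ℝ) :
    HasMean (fun φ => ∑ i, A i * Real.cos (κ i * φ + x i)) 0 := by
  simpa using sum Finset.univ fun i _ => (cos (hκ i).ne' (x i)).const_mul (A i)

theorem sum_cos_sq {ι : Type*} [Fintype ι] {κ : ι → ℝ} (hκ : ∀ i, 0 < κ i)
    (hinj : Function.Injective κ) (A x : ι → ℝ) :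
    HasMean (fun φ => (∑ i, A i * Real.cos (κ i * φ + x i)) ^ 2) (1 / 2 * ∑ i, A i ^ 2) := by
  classical
  have hpair : ∀ i j, HasMean
      (fun φ => Real.cos (κ i * φ + x i) * Real.cos (κ j * φ + x j))
      (if i = j then 1 / 2 else 0) := fun i j => by
    split_ifs with hij
    · subst hij
      exact cos_sq (hκ i) (x i)
    · exact cos_mul_cos (hκ i) (hκ j) (hinj.ne hij) _ _
  refine (sum Finset.univ fun i _ =>
    sum Finset.univ fun j _ => (hpair i j).const_mul (A i * A j)).congr (fun φ => ?_) ?_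
  · rw [sq, Finset.sum_mul_sum]
    refine Finset.sum_congr rfl fun i _ => Finset.sum_congr rfl fun j _ => ?_
    ring
  · simp only [mul_ite, mul_zero, Finset.sum_ite_eq, Finset.mem_univ, if_true, Finset.mul_sum]
    refine Finset.sum_congr rfl fun i _ => ?_
    ring

end HasMean

/-- Oscillatory and total energy density of a harmonic travelling wave:
with `Φ(r) = ½ c₀² r² + d₁ r + d₀` and `A² = Σ A_i²`, the averaged oscillatory
energy equals `½ c₀² A²` and the averaged total energy density equals
`½ V² + ½ c₀² R² + d₁ R + d₀ + ½ c₀² A²`. -/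
theorem harmonic_wave_oscillatory_and_total_energy
    (c₀ c R V d₁ d₀ : ℝ) (hc₀ : 0 < c₀) (hc : 0 < c)
    (M : ℕ) (hM : 1 ≤ M) (A η κ : Fin M → ℝ) (hκ : ∀ i, 0 < κ i)
    (hinj : Function.Injective κ)
    (hdisp : ∀ i, c * κ i = 2 * c₀ * Real.sin (κ i / 2))
    (𝓡 𝓥 : ℝ → ℝ)
    (h𝓡 : ∀ φ : ℝ, 𝓡 φ = R + ∑ i, A i * Real.cos (κ i * φ + κ i / 2 + η i))
    (h𝓥 : ∀ φ : ℝ, 𝓥 φ = V - c₀ * ∑ i, A i * Real.cos (κ i * φ + η i))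
    (Φ : ℝ → ℝ) (hΦ : ∀ x : ℝ, Φ x = (1 / 2) * c₀ ^ 2 * x ^ 2 + d₁ * x + d₀)
    (Asq : ℝ) (hAsq : Asq = ∑ i, (A i) ^ 2) :
    Tendsto (fun L : ℝ => (1 / (2 * L)) *
        ∫ φ in (-L)..L, ((1 / 2) * (𝓥 φ - V) ^ 2 + (Φ (𝓡 φ) - Φ R)))
      atTop (nhds ((1 / 2) * c₀ ^ 2 * Asq)) ∧
    Tendsto (fun L : ℝ => (1 / (2 * L)) *
        ∫ φ in (-L)..L, ((1 / 2) * (𝓥 φ) ^ 2 + Φ (𝓡 φ)))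
      atTop (nhds ((1 / 2) * V ^ 2 + (1 / 2) * c₀ ^ 2 * R ^ 2 + d₁ * R + d₀ +
        (1 / 2) * c₀ ^ 2 * Asq)) := by
  have hV := HasMean.sum_cos hκ A η
  have hV2 := HasMean.sum_cos_sq hκ hinj A η
  have hR := HasMean.sum_cos hκ A fun i => κ i / 2 + η i
  have hR2 := HasMean.sum_cos_sq hκ hinj A fun i => κ i / 2 + η i
  have hosc := ((hV2.add hR2).const_mul (1 / 2 * c₀ ^ 2)).add (hR.const_mul (c₀ ^ 2 * R + d₁))
  have htot := (hosc.add (hV.const_mul (-(V * c₀)))).add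
    (HasMean.const (1 / 2 * V ^ 2 + 1 / 2 * c₀ ^ 2 * R ^ 2 + d₁ * R + d₀))
  simp only [h𝓡, h𝓥, hΦ, hAsq, add_assoc (κ _ * _)]
  constructor
  · exact (hosc.congr (fun φ => by ring) (by ring)).2
  · exact (htot.congr (fun φ => by ring) (by ring)).2
end

section
/- Let κ ∈ (0, π) and σ = 2 sin(κ/2). Define x_j^±(t) = sin(κ|j| ∓ σ t)/(2 sin κ) for j ∈ ℤ and t ∈ ℝ. Then both x^+ and x^− solve the forced lattice wave equation ẍ_j(t) = x_{j+1}(t) + x_{j−1}(t) − 2 x_j(t) + ζ(t) δ_{j0} with forcing ζ(t) = −cos(σ t). -/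
theorem deriv_deriv_sin_affine_div (a s c t : ℝ) :
    deriv (deriv fun t : ℝ => Real.sin (a + s * t) / c) t =
      -s ^ 2 * (Real.sin (a + s * t) / c) := by
  have haff : ∀ t : ℝ, HasDerivAt (fun t : ℝ => a + s * t) s t := fun t => by
    simpa using ((hasDerivAt_id t).const_mul s).const_add a
  have hfst : (deriv fun t : ℝ => Real.sin (a + s * t) / c) =
      fun t => Real.cos (a + s * t) * s / c :=
    funext fun t => ((haff t).sin.div_const c).deriv
  rw [hfst, (((haff t).cos.mul_const s).div_const c).deriv]
  ring

/-- Travelling waves emitted from the origin solve the forced lattice wave equation for either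
sign of the frequency `s`, provided `s` satisfies the dispersion relation. -/
theorem deriv_deriv_eq_of_dispersion {κ s : ℝ} (hκ : Real.sin κ ≠ 0)
    (hs : s ^ 2 = 2 * (1 - Real.cos κ)) {x : ℤ → ℝ → ℝ}
    (hx : ∀ (j : ℤ) (t : ℝ),
      x j t = Real.sin (κ * ((|j| : ℤ) : ℝ) + s * t) / (2 * Real.sin κ))
    (j : ℤ) (t : ℝ) :
    deriv (deriv (x j)) t =
      x (j + 1) t + x (j - 1) t - 2 * x j t + -Real.cos (s * t) * (if j = 0 then 1 else 0) := by
  rw [funext (hx j), deriv_deriv_sin_affine_div, hx, hx, hs]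
  have hsum : ∀ θ : ℝ, Real.sin (θ + κ) + Real.sin (θ - κ) = 2 * Real.cos κ * Real.sin θ :=
    fun θ => by rw [Real.sin_add, Real.sin_sub]; ring
  rcases lt_trichotomy j 0 with hj | rfl | hj
  · rw [abs_of_neg hj, abs_of_nonpos (by omega : j + 1 ≤ 0), abs_of_neg (by omega : j - 1 < 0),
      if_neg hj.ne]
    push_cast
    have h := hsum (κ * -(j : ℝ) + s * t)
    rw [show κ * -((j : ℝ) + 1) + s * t = κ * -(j : ℝ) + s * t - κ by ring,
      show κ * -((j : ℝ) - 1) + s * t = κ * -(j : ℝ) + s * t + κ by ring]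
    linear_combination -h / (2 * Real.sin κ)
  · simp only [zero_add, zero_sub, abs_neg, abs_one, abs_zero, Int.cast_one, Int.cast_zero,
      mul_one, mul_zero, if_true, Real.sin_add]
    field_simp
    ring
  · rw [abs_of_pos hj, abs_of_pos (by omega : 0 < j + 1), abs_of_nonneg (by omega : 0 ≤ j - 1),
      if_neg hj.ne']
    push_cast
    have h := hsum (κ * (j : ℝ) + s * t)
    rw [show κ * ((j : ℝ) + 1) + s * t = κ * (j : ℝ) + s * t + κ by ring,
      show κ * ((j : ℝ) - 1) + s * t = κ * (j : ℝ) + s * t - κ by ring]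
    linear_combination -h / (2 * Real.sin κ)

/-- The two special solutions `x_j^±(t) = sin(κ|j| ∓ σ t)/(2 sin κ)` solve the
forced lattice wave equation `ẍ_j = x_{j+1} + x_{j−1} − 2 x_j + ζ(t) δ_{j0}`
with forcing `ζ(t) = −cos(σ t)`, where `σ = 2 sin(κ/2)`, `κ ∈ (0, π)`. -/
theorem forced_lattice_special_solutions
    (κ σ : ℝ) (hκ : κ ∈ Set.Ioo 0 Real.pi) (hσ : σ = 2 * Real.sin (κ / 2))
    (ζ : ℝ → ℝ) (hζ : ∀ t : ℝ, ζ t = -Real.cos (σ * t))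
    (xp xm : ℤ → ℝ → ℝ)
    (hxp : ∀ (j : ℤ) (t : ℝ),
      xp j t = Real.sin (κ * ((|j| : ℤ) : ℝ) - σ * t) / (2 * Real.sin κ))
    (hxm : ∀ (j : ℤ) (t : ℝ),
      xm j t = Real.sin (κ * ((|j| : ℤ) : ℝ) + σ * t) / (2 * Real.sin κ)) :
    (∀ (j : ℤ) (t : ℝ),
      deriv (deriv (xp j)) t =
        xp (j + 1) t + xp (j - 1) t - 2 * xp j t +
          ζ t * (if j = 0 then 1 else 0)) ∧
    (∀ (j : ℤ) (t : ℝ),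
      deriv (deriv (xm j)) t =
        xm (j + 1) t + xm (j - 1) t - 2 * xm j t +
          ζ t * (if j = 0 then 1 else 0)) := by
  have hsin : Real.sin κ ≠ 0 := (Real.sin_pos_of_mem_Ioo hκ).ne'
  have hdisp : σ ^ 2 = 2 * (1 - Real.cos κ) := by
    have hcos := Real.cos_sq (κ / 2)
    rw [mul_div_cancel₀ κ (two_ne_zero' ℝ)] at hcos
    rw [hσ]
    linear_combination 4 * Real.sin_sq_add_cos_sq (κ / 2) - 4 * hcos
  refine ⟨fun j t => ?_, fun j t => ?_⟩
  · have h := deriv_deriv_eq_of_dispersion (s := -σ) (x := xp) hsin (by rwa [neg_sq])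
      (fun j t => by rw [hxp, neg_mul, sub_eq_add_neg]) j t
    rwa [neg_mul σ t, Real.cos_neg, ← hζ] at h
  · rw [hζ]
    exact deriv_deriv_eq_of_dispersion hsin hdisp hxm j t
end

section
/- Let κ ∈ (0, π), σ = 2 sin(κ/2), A = 1/(2 cos(κ/2)), and x_j^±(t) = sin(κ|j| ∓ σ t)/(2 sin κ), solving the forced lattice equation with forcing ζ(t) = −cos(σ t) at j = 0. Then the macroscopic energy production, given by the time average of the power supplied by the forcing, satisfies θ^± := (σ/(2π)) ∫_0^{2π/σ} ẋ_0^±(t) ζ(t) dt = ± A/2. In particular θ^+ > 0 (the solution x^+ is a source of energy) and θ^− < 0 (the solution x^− is a sink of energy). -/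
theorem integral_cos_mul_sq_period {σ : ℝ} (hσ : σ ≠ 0) :
    ∫ t in (0 : ℝ)..(2 * Real.pi / σ), Real.cos (σ * t) ^ 2 = Real.pi / σ := by
  rw [intervalIntegral.integral_comp_mul_left (fun x => Real.cos x ^ 2) hσ, integral_cos_sq,
    mul_div_cancel₀ _ hσ]
  simp only [mul_zero, Real.sin_zero, Real.sin_two_pi, smul_eq_mul]
  field_simp
  ring

/-- The time average of the power that the forcing `-cos (σ t)` transfers to the particle
with trajectory `c * sin (σ t)`. -/
theorem average_power_of_sin {σ c : ℝ} (hσ : σ ≠ 0) {x ζ : ℝ → ℝ}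
    (hx : ∀ t, x t = c * Real.sin (σ * t)) (hζ : ∀ t, ζ t = -Real.cos (σ * t)) :
    (σ / (2 * Real.pi)) * (∫ t in (0 : ℝ)..(2 * Real.pi / σ), deriv x t * ζ t) =
      -(c * σ / 2) := by
  have hpower : ∀ t, deriv x t * ζ t = -(c * σ) * Real.cos (σ * t) ^ 2 := fun t => by
    have hd : HasDerivAt x (c * (Real.cos (σ * t) * (σ * 1))) t := by
      rw [funext hx]
      exact (((hasDerivAt_id t).const_mul σ).sin).const_mul c
    rw [hd.deriv, hζ]
    ring
  simp only [hpower]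
  rw [intervalIntegral.integral_const_mul, integral_cos_mul_sq_period hσ]
  have := Real.pi_ne_zero
  field_simp

/-- Macroscopic energy production of the special solutions: the time average
`θ^± = (σ/(2π)) ∫₀^{2π/σ} ẋ₀^±(t) ζ(t) dt` of the power supplied by the
forcing `ζ(t) = −cos(σt)` equals `± A/2`; in particular `θ^+ > 0` (source)
and `θ^− < 0` (sink). -/
theorem forced_lattice_energy_production
    (κ σ A : ℝ) (hκ : κ ∈ Set.Ioo 0 Real.pi) (hσ : σ = 2 * Real.sin (κ / 2))
    (hA : A = 1 / (2 * Real.cos (κ / 2)))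
    (ζ : ℝ → ℝ) (hζ : ∀ t : ℝ, ζ t = -Real.cos (σ * t))
    (xp xm : ℤ → ℝ → ℝ)
    (hxp : ∀ (j : ℤ) (t : ℝ),
      xp j t = Real.sin (κ * ((|j| : ℤ) : ℝ) - σ * t) / (2 * Real.sin κ))
    (hxm : ∀ (j : ℤ) (t : ℝ),
      xm j t = Real.sin (κ * ((|j| : ℤ) : ℝ) + σ * t) / (2 * Real.sin κ)) :
    (σ / (2 * Real.pi)) *
        (∫ t in (0 : ℝ)..(2 * Real.pi / σ), deriv (xp 0) t * ζ t) = A / 2 ∧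
    (σ / (2 * Real.pi)) *
        (∫ t in (0 : ℝ)..(2 * Real.pi / σ), deriv (xm 0) t * ζ t) = -(A / 2) ∧
    0 < A / 2 ∧ -(A / 2) < 0 := by
  obtain ⟨h0, hπ⟩ := hκ
  have hs : 0 < Real.sin (κ / 2) := Real.sin_pos_of_pos_of_lt_pi (by linarith) (by linarith)
  have hc : 0 < Real.cos (κ / 2) := Real.cos_pos_of_mem_Ioo ⟨by linarith, by linarith⟩
  have hsin : Real.sin κ = 2 * Real.sin (κ / 2) * Real.cos (κ / 2) := by
    rw [← Real.sin_two_mul, mul_div_cancel₀ κ two_ne_zero]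
  have hσ0 : σ ≠ 0 := by rw [hσ]; positivity
  have hcoeff : 1 / (2 * Real.sin κ) * σ / 2 = A / 2 := by
    rw [hsin, hσ, hA]
    field_simp
  have hA0 : 0 < A / 2 := by rw [hA]; positivity
  have hp : ∀ t, xp 0 t = -(1 / (2 * Real.sin κ)) * Real.sin (σ * t) := fun t => by
    rw [hxp, abs_zero, Int.cast_zero, mul_zero, zero_sub, Real.sin_neg]
    ring
  have hm : ∀ t, xm 0 t = 1 / (2 * Real.sin κ) * Real.sin (σ * t) := fun t => by
    rw [hxm, abs_zero, Int.cast_zero, mul_zero, zero_add]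
    ring
  refine ⟨?_, ?_, hA0, neg_lt_zero.mpr hA0⟩
  · rw [average_power_of_sin hσ0 hp hζ, ← hcoeff]
    ring
  · rw [average_power_of_sin hσ0 hm hζ, hcoeff]
end

section
/- Let κ ∈ (0, π), σ = 2 sin(κ/2), A = 1/(2 cos(κ/2)), and x_j^±(t) = sin(κ|j| ∓ σ t)/(2 sin κ). With v_j^± = ẋ_j^± and r_j^± = x_{j+1}^± − x_j^±, the time-averaged energy flux F_j^± := (σ/(2π)) ∫_0^{2π/σ} ( −v_j^±(t) r_j^±(t) ) dt satisfies F_j^± = ± A/4 for every j ≥ 1 and F_j^± = ∓ A/4 for every j ≤ −1. Consequently the energy production θ^± = ± A/2 equals the jump F_{+}^± − F_{−}^± of the flux across j = 0; for x^+ the fluxes on both sides point away from the source, while for x^− they point towards the sink. -/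
/-- Mean flux `-v r` between two phase-shifted waves `sin (a + s t) / c` and `sin (b + s t) / c`,
over a time `T` containing a whole number of periods. -/
theorem mean_flux_of_sinusoids (a b c s T : ℝ) (n : ℤ) (hT : T ≠ 0)
    (hsT : s * T = n * (2 * Real.pi)) :
    T⁻¹ * (∫ t in (0 : ℝ)..T, -(deriv (fun t => Real.sin (a + s * t) / c) t *
      (Real.sin (b + s * t) / c - Real.sin (a + s * t) / c))) =
      -(s * Real.sin (b - a) / (2 * c ^ 2)) := by
  have hlin (d m t : ℝ) : HasDerivAt (fun t => d + m * t) m t := by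
    simpa using ((hasDerivAt_id t).const_mul m).const_add d
  have hderiv (t : ℝ) :
      deriv (fun t => Real.sin (a + s * t) / c) t = Real.cos (a + s * t) * s / c :=
    ((hlin a s t).sin.div_const c).deriv
  have hprod (t : ℝ) : 2 * (Real.cos (a + s * t) * Real.sin (b + s * t)) =
      Real.sin (b - a) + Real.sin (a + b + 2 * s * t) := by
    rw [show b - a = (b + s * t) - (a + s * t) by ring,
      show a + b + 2 * s * t = (b + s * t) + (a + s * t) by ring, Real.sin_sub,
      Real.sin_add (b + s * t) (a + s * t)]
    ring
  have hsq (t : ℝ) : Real.sin (2 * a + 2 * s * t) =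
      2 * Real.sin (a + s * t) * Real.cos (a + s * t) := by
    rw [← Real.sin_two_mul]
    ring_nf
  have hprim (t : ℝ) : HasDerivAt
      (fun t => (-(2 * s * Real.sin (b - a)) * t + Real.cos (a + b + 2 * s * t)
        - Real.cos (2 * a + 2 * s * t)) / (4 * c ^ 2))
      (-(Real.cos (a + s * t) * s / c *
        (Real.sin (b + s * t) / c - Real.sin (a + s * t) / c))) t := by
    have h := ((((hasDerivAt_id t).const_mul (-(2 * s * Real.sin (b - a)))).add
      (hlin (a + b) (2 * s) t).cos).sub (hlin (2 * a) (2 * s) t).cos).div_const (4 * c ^ 2)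
    refine h.congr_deriv ?_
    rw [hsq]
    linear_combination (s / (2 * c ^ 2)) * hprod t
  simp only [hderiv]
  rw [intervalIntegral.integral_eq_sub_of_hasDerivAt (fun t _ => hprim t)
    (Continuous.intervalIntegrable (by fun_prop) _ _)]
  have hper (d : ℝ) : Real.cos (d + 2 * s * T) = Real.cos d := by
    rw [show d + 2 * s * T = d + (2 * n : ℤ) * (2 * Real.pi) by
      push_cast
      linear_combination 2 * hsT]
    exact Real.cos_add_int_mul_two_pi _ _
  simp only [hper, mul_zero, add_zero]
  field_simp
  ring

/-- Time-averaged energy fluxes of the special solutions: with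
`F_j^± = (σ/(2π)) ∫₀^{2π/σ} (−v_j^± r_j^±) dt`, one has `F_j^± = ± A/4` for
`j ≥ 1` and `F_j^± = ∓ A/4` for `j ≤ −1`; consequently the jump of the flux
across `j = 0` equals the energy production `θ^± = ± A/2`. -/
theorem forced_lattice_energy_fluxes
    (κ σ A : ℝ) (hκ : κ ∈ Set.Ioo 0 Real.pi) (hσ : σ = 2 * Real.sin (κ / 2))
    (hA : A = 1 / (2 * Real.cos (κ / 2)))
    (xp xm : ℤ → ℝ → ℝ)
    (hxp : ∀ (j : ℤ) (t : ℝ),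
      xp j t = Real.sin (κ * ((|j| : ℤ) : ℝ) - σ * t) / (2 * Real.sin κ))
    (hxm : ∀ (j : ℤ) (t : ℝ),
      xm j t = Real.sin (κ * ((|j| : ℤ) : ℝ) + σ * t) / (2 * Real.sin κ))
    (Fp Fm : ℤ → ℝ)
    (hFp : ∀ j : ℤ, Fp j = (σ / (2 * Real.pi)) *
      ∫ t in (0 : ℝ)..(2 * Real.pi / σ),
        -(deriv (xp j) t * (xp (j + 1) t - xp j t)))
    (hFm : ∀ j : ℤ, Fm j = (σ / (2 * Real.pi)) *
      ∫ t in (0 : ℝ)..(2 * Real.pi / σ),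
        -(deriv (xm j) t * (xm (j + 1) t - xm j t))) :
    (∀ j : ℤ, 1 ≤ j → Fp j = A / 4 ∧ Fm j = -(A / 4)) ∧
    (∀ j : ℤ, j ≤ -1 → Fp j = -(A / 4) ∧ Fm j = A / 4) ∧
    (∀ j k : ℤ, 1 ≤ j → k ≤ -1 →
      Fp j - Fp k = A / 2 ∧ Fm j - Fm k = -(A / 2)) := by
  obtain ⟨h0, hπ⟩ := hκ
  have hsin : 0 < Real.sin (κ / 2) := Real.sin_pos_of_pos_of_lt_pi (by linarith) (by linarith)
  have hcos : 0 < Real.cos (κ / 2) := Real.cos_pos_of_mem_Ioo ⟨by linarith, by linarith⟩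
  have hdouble : Real.sin κ = 2 * Real.sin (κ / 2) * Real.cos (κ / 2) := by
    rw [← Real.sin_two_mul]
    ring_nf
  have hσ0 : σ ≠ 0 := by rw [hσ]; positivity
  have hT : 2 * Real.pi / σ ≠ 0 := div_ne_zero Real.two_pi_pos.ne' hσ0
  have hflux : σ * Real.sin κ / (2 * (2 * Real.sin κ) ^ 2) = A / 4 := by
    rw [hA, hσ, hdouble]
    field_simp
    norm_num
  have hxp' (j : ℤ) : xp j =
      fun t => Real.sin (κ * ((|j| : ℤ) : ℝ) + -σ * t) / (2 * Real.sin κ) := by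
    funext t
    rw [hxp]
    ring_nf
  have hxm' (j : ℤ) : xm j =
      fun t => Real.sin (κ * ((|j| : ℤ) : ℝ) + σ * t) / (2 * Real.sin κ) :=
    funext (hxm j)
  have hFp' (j : ℤ) : Fp j =
      σ * Real.sin (κ * ((|j + 1| : ℤ) : ℝ) - κ * ((|j| : ℤ) : ℝ)) /
        (2 * (2 * Real.sin κ) ^ 2) := by
    rw [hFp, ← inv_div, hxp', hxp',
      mean_flux_of_sinusoids _ _ _ _ _ (-1) hT (by push_cast; field_simp)]
    ring
  have hFm' (j : ℤ) : Fm j =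
      -(σ * Real.sin (κ * ((|j + 1| : ℤ) : ℝ) - κ * ((|j| : ℤ) : ℝ)) /
        (2 * (2 * Real.sin κ) ^ 2)) := by
    rw [hFm, ← inv_div, hxm', hxm',
      mean_flux_of_sinusoids _ _ _ _ _ 1 hT (by push_cast; field_simp)]
  have hright (j : ℤ) (hj : 1 ≤ j) : Fp j = A / 4 ∧ Fm j = -(A / 4) := by
    have hphase : κ * ((|j + 1| : ℤ) : ℝ) - κ * ((|j| : ℤ) : ℝ) = κ := by
      rw [abs_of_nonneg (by omega : 0 ≤ j + 1), abs_of_nonneg (by omega : 0 ≤ j)]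
      push_cast
      ring
    rw [hFp', hFm', hphase, hflux]
    exact ⟨rfl, rfl⟩
  have hleft (j : ℤ) (hj : j ≤ -1) : Fp j = -(A / 4) ∧ Fm j = A / 4 := by
    have hphase : κ * ((|j + 1| : ℤ) : ℝ) - κ * ((|j| : ℤ) : ℝ) = -κ := by
      rw [abs_of_nonpos (by omega : j + 1 ≤ 0), abs_of_nonpos (by omega : j ≤ 0)]
      push_cast
      ring
    rw [hFp', hFm', hphase, Real.sin_neg, mul_neg, neg_div, hflux, neg_neg]
    exact ⟨rfl, rfl⟩
  refine ⟨hright, hleft, fun j k hj hk => ?_⟩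
  rw [(hright j hj).1, (hright j hj).2, (hleft k hk).1, (hleft k hk).2]
  constructor <;> ring
end

section
/- For every c with 2√2/π < c < 1, the dispersion equation c² k² = 4 sin²(k/2) has exactly one solution k > 0, and this solution lies in the interval (0, π). -/
/-- On `[0, π]` a line through the origin meets the graph of `sin` in at most one positive point. -/
theorem sin_eq_mul_unique {c x y : ℝ} (hx : 0 < x) (hy : y ≤ Real.pi) (hxy : x < y)
    (hsx : Real.sin x = c * x) (hsy : Real.sin y = c * y) : False := by
  have h := strictConcaveOn_sin_Icc.slope_anti_adjacent
    (Set.left_mem_Icc.2 Real.pi_pos.le) ⟨(hx.trans hxy).le, hy⟩ hx hxy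
  rw [hsx, hsy, Real.sin_zero, sub_zero, sub_zero, ← mul_sub,
    mul_div_cancel_right₀ _ (sub_pos.2 hxy).ne', mul_div_cancel_right₀ _ hx.ne'] at h
  exact lt_irrefl _ h

/-- A line through the origin of slope in `(2 / π, 1)` meets the graph of `sin` above
`(0, π / 2)`. -/
theorem exists_sin_eq_mul {c : ℝ} (hc : 1 < c * (Real.pi / 2)) (hc0 : 0 < c) (hc1 : c < 1) :
    ∃ x, 0 < x ∧ Real.sin x = c * x := by
  have hpi := Real.pi_gt_three
  have hsin := Real.sin_gt_sub_cube (x := 1 - c) (by linarith)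
  have hpos : c * (1 - c) ≤ Real.sin (1 - c) := by
    nlinarith [mul_pos (pow_pos (sub_pos.2 hc1) 2) (show 0 < 5 + c by linarith)]
  obtain ⟨x, hx, hfx⟩ := intermediate_value_Icc' (show 1 - c ≤ Real.pi / 2 by linarith)
    (f := fun x => Real.sin x - c * x) (by fun_prop)
    (show (0 : ℝ) ∈ Set.Icc _ _ from
      ⟨by simp only [Real.sin_pi_div_two]; linarith, by linarith⟩)
  exact ⟨x, by linarith [hx.1], sub_eq_zero.1 hfx⟩

/-- For `2√2/π < c < 1` the dispersion equation `c² k² = 4 sin²(k/2)` has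
exactly one solution `k > 0`, and this solution lies in `(0, π)`. -/
theorem dispersion_equation_unique_solution
    (c : ℝ) (h₁ : 2 * Real.sqrt 2 / Real.pi < c) (h₂ : c < 1) :
    (∃! k : ℝ, 0 < k ∧ c ^ 2 * k ^ 2 = 4 * Real.sin (k / 2) ^ 2) ∧
    (∀ k : ℝ, 0 < k → c ^ 2 * k ^ 2 = 4 * Real.sin (k / 2) ^ 2 →
      k < Real.pi) := by
  have hpi := Real.pi_pos
  have hc0 : 0 < c := lt_trans (by positivity) h₁
  have hcpi : 2 < c * Real.pi := by
    rw [div_lt_iff₀ hpi] at h₁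
    linarith [Real.one_lt_sqrt_two]
  have hlt : ∀ k : ℝ, 0 < k → c ^ 2 * k ^ 2 = 4 * Real.sin (k / 2) ^ 2 → k < Real.pi := by
    intro k _ hk
    by_contra! hge
    nlinarith [Real.sin_sq_le_one (k / 2), mul_le_mul_of_nonneg_left hge hc0.le]
  have hsin : ∀ k : ℝ, 0 < k → c ^ 2 * k ^ 2 = 4 * Real.sin (k / 2) ^ 2 →
      Real.sin (k / 2) = c * (k / 2) := by
    intro k hk h
    have hs := Real.sin_nonneg_of_nonneg_of_le_pi (x := k / 2) (by linarith)
      (by linarith [hlt k hk h])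
    refine (sq_eq_sq₀ hs (by positivity)).1 ?_
    linarith
  refine ⟨?_, hlt⟩
  obtain ⟨x, hx, hxs⟩ := exists_sin_eq_mul (by linarith) hc0 h₂
  have hk : c ^ 2 * (2 * x) ^ 2 = 4 * Real.sin (2 * x / 2) ^ 2 := by
    rw [mul_div_cancel_left₀ x two_ne_zero, hxs]
    ring
  refine ⟨2 * x, ⟨by linarith, hk⟩, ?_⟩
  rintro k ⟨hk0, hk'⟩
  have hkpi := hlt k hk0 hk'
  have hxpi := hlt (2 * x) (by linarith) hk
  rcases lt_trichotomy (k / 2) x with h | h | h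
  · exact (sin_eq_mul_unique (by linarith) (by linarith) h (hsin k hk0 hk') hxs).elim
  · linarith
  · exact (sin_eq_mul_unique hx (by linarith) h hxs (hsin k hk0 hk')).elim
end

section
/- Let c, c_gr ∈ ℝ with c² ≠ 1, and let R_{±∞}, V_{±∞} ∈ ℝ satisfy the jump conditions c⟦R⟧ = −⟦V⟧ and c⟦V⟧ = ⟦P⟧ with P_{±∞} = −R_{±∞} ± 1. Define E_{non,±∞} = ½ V_{±∞}² + Φ(R_{±∞}), where Φ(R_{+∞}) = ½(R_{+∞} − 1)² and Φ(R_{−∞}) = ½(R_{−∞} + 1)², and let E_{osc,±∞} ∈ ℝ with Q_{±∞} = c_gr E_{osc,±∞}. Then: (i) −c ⟦E_non⟧ + ⟦P V⟧ = 2c ⟨R⟩, where ⟦X⟧ = X_{+∞} − X_{−∞} and ⟨X⟩ = ½(X_{+∞} + X_{−∞}); (ii) −c ⟦E_osc⟧ + ⟦Q⟧ = (c_gr − c) ⟦E_osc⟧; (iii) if additionally the total-energy jump condition c ⟦E_non + E_osc⟧ = ⟦P V + Q⟧ holds, then −2c ⟨R⟩ = (c_gr − c) ⟦E_osc⟧.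 -/
/-- Energy balances across a phase transition interface: with
`P_{±∞} = −R_{±∞} ± 1`, `E_{non,±∞} = ½V_{±∞}² + Φ(R_{±∞})` (with the strains
in the respective wells of the bi-quadratic potential) and `Q_{±∞} = c_gr E_{osc,±∞}`,
the jump conditions for mass and momentum imply
(i) `−c⟦E_non⟧ + ⟦PV⟧ = 2c⟨R⟩`,
(ii) `−c⟦E_osc⟧ + ⟦Q⟧ = (c_gr − c)⟦E_osc⟧`, and
(iii) if moreover `c⟦E_non + E_osc⟧ = ⟦PV + Q⟧`, then
`−2c⟨R⟩ = (c_gr − c)⟦E_osc⟧`. -/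
theorem phase_transition_energy_balance
    (c cgr Rm Rp Vm Vp Pm Pp : ℝ) (hc : c ^ 2 ≠ 1)
    (hPm : Pm = -Rm - 1) (hPp : Pp = -Rp + 1)
    (hmass : c * (Rp - Rm) = -(Vp - Vm))
    (hmom : c * (Vp - Vm) = Pp - Pm)
    (Enm Enp : ℝ)
    (hEnm : Enm = (1 / 2) * Vm ^ 2 + (1 / 2) * (Rm + 1) ^ 2)
    (hEnp : Enp = (1 / 2) * Vp ^ 2 + (1 / 2) * (Rp - 1) ^ 2)
    (Eom Eop Qm Qp : ℝ) (hQm : Qm = cgr * Eom) (hQp : Qp = cgr * Eop) :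
    (-c * (Enp - Enm) + (Pp * Vp - Pm * Vm) = 2 * c * ((Rp + Rm) / 2)) ∧
    (-c * (Eop - Eom) + (Qp - Qm) = (cgr - c) * (Eop - Eom)) ∧
    (c * ((Enp + Eop) - (Enm + Eom)) = (Pp * Vp + Qp) - (Pm * Vm + Qm) →
      -(2 * c) * ((Rp + Rm) / 2) = (cgr - c) * (Eop - Eom)) := by
  subst hPm hPp hEnm hEnp hQm hQp
  have nonosc : -c * (((1 / 2) * Vp ^ 2 + (1 / 2) * (Rp - 1) ^ 2) -
      ((1 / 2) * Vm ^ 2 + (1 / 2) * (Rm + 1) ^ 2)) +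
      ((-Rp + 1) * Vp - (-Rm - 1) * Vm) = 2 * c * ((Rp + Rm) / 2) := by
    linear_combination -((Vp + Vm) / 2) * hmom - ((Rp + Rm) / 2) * hmass
  refine ⟨nonosc, by ring, fun htotal => ?_⟩
  linear_combination htotal + nonosc
end
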